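/- The logic ITL¹ is sound for the class of persistent dynamic posets: if ITL¹ ⊢ φ, then for every dynamic poset (X,≼,S) in which S is both continuous and open with respect to the up-set topology, and every valuation ⟦·⟧ on it, ⟦φ⟧ = X. -/

import Mathlib

/-- Formulas of the language `L` of intuitionistic linear temporal logic. -/
inductive Formula : Type
  | bot : Formula
  | var : ℕ → Formula
  | and : Formula → Formula → Formula
  | or : Formula → Formula → Formula
  | impl : Formula → Formula → Formula
  | next : Formula → Formula
  | diam : Formula → Formula
  | box : Formula → Formula
deriving DecidableEq

namespace Formula

/-- `¬φ` abbreviates `φ → ⊥`. -/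
def neg (φ : Formula) : Formula := impl φ bot

/-- `φ ↔ ψ` abbreviates `(φ → ψ) ∧ (ψ → φ)`. -/
def iff (φ ψ : Formula) : Formula := and (impl φ ψ) (impl ψ φ)

end Formula

/-- Derivability in `ITL⁰` extended with an additional set of axioms `Ax`.
The intuitionistic propositional tautologies are generated by a standard
complete Hilbert-style axiomatization of intuitionistic propositional logic
(closed under modus ponens). -/
inductive ITL (Ax : Formula → Prop) : Formula → Prop
  | extra {φ} : Ax φ → ITL Ax φ
  -- (i) intuitionistic propositional axioms
  | then1 (φ ψ : Formula) : ITL Ax (.impl φ (.impl ψ φ))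
  | then2 (φ ψ χ : Formula) :
      ITL Ax (.impl (.impl φ (.impl ψ χ)) (.impl (.impl φ ψ) (.impl φ χ)))
  | andE1 (φ ψ : Formula) : ITL Ax (.impl (.and φ ψ) φ)
  | andE2 (φ ψ : Formula) : ITL Ax (.impl (.and φ ψ) ψ)
  | andI (φ ψ : Formula) : ITL Ax (.impl φ (.impl ψ (.and φ ψ)))
  | orI1 (φ ψ : Formula) : ITL Ax (.impl φ (.or φ ψ))
  | orI2 (φ ψ : Formula) : ITL Ax (.impl ψ (.or φ ψ))
  | orE (φ ψ χ : Formula) :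
      ITL Ax (.impl (.impl φ χ) (.impl (.impl ψ χ) (.impl (.or φ ψ) χ)))
  | botE (φ : Formula) : ITL Ax (.impl .bot φ)
  -- (ii)–(x) temporal axioms
  | nextBot : ITL Ax (.neg (.next .bot))
  | nextAnd (φ ψ : Formula) :
      ITL Ax (.iff (.next (.and φ ψ)) (.and (.next φ) (.next ψ)))
  | nextOr (φ ψ : Formula) :
      ITL Ax (.iff (.next (.or φ ψ)) (.or (.next φ) (.next ψ)))
  | nextK (φ ψ : Formula) :
      ITL Ax (.impl (.next (.impl φ ψ)) (.impl (.next φ) (.next ψ)))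
  | boxK (φ ψ : Formula) :
      ITL Ax (.impl (.box (.impl φ ψ)) (.impl (.box φ) (.box ψ)))
  | diamK (φ ψ : Formula) :
      ITL Ax (.impl (.box (.impl φ ψ)) (.impl (.diam φ) (.diam ψ)))
  | diamOr (φ ψ : Formula) :
      ITL Ax (.impl (.diam (.or φ ψ)) (.or (.diam φ) (.diam ψ)))
  | boxFix (φ : Formula) : ITL Ax (.impl (.box φ) (.and φ (.next (.box φ))))
  | diamFix (φ : Formula) : ITL Ax (.impl (.or φ (.next (.diam φ))) (.diam φ))
  -- rules (xi)–(xiv)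
  | ind1 {φ : Formula} : ITL Ax (.impl φ (.next φ)) → ITL Ax (.impl φ (.box φ))
  | ind2 {φ : Formula} : ITL Ax (.impl (.next φ) φ) → ITL Ax (.impl (.diam φ) φ)
  | mp {φ ψ : Formula} : ITL Ax (.impl φ ψ) → ITL Ax φ → ITL Ax ψ
  | nec {φ : Formula} : ITL Ax φ → ITL Ax (.next φ)

/-- The Fischer Servi axiom schemes FS◦ and FS◇. -/
def FSAx : Formula → Prop := fun χ => ∃ φ ψ : Formula,
  χ = .impl (.impl (.next φ) (.next ψ)) (.next (.impl φ ψ)) ∨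
  χ = .impl (.impl (.diam φ) (.box ψ)) (.box (.impl φ ψ))

/-- The constant domain axiom scheme CD. -/
def CDAx : Formula → Prop := fun χ => ∃ φ ψ : Formula,
  χ = .impl (.box (.or φ ψ)) (.or (.box φ) (.diam ψ))

/-- The logic ITL⁰. -/
def ITL0 : Formula → Prop := ITL (fun _ => False)

/-- The logic ITL^FS = ITL⁰ + FS◦ + FS◇. -/
def ITLFS : Formula → Prop := ITL FSAx

/-- The logic ITL^CD = ITL⁰ + CD. -/
def ITLCD : Formula → Prop := ITL CDAx

/-- The logic ITL¹ = ITL^FS + ITL^CD. -/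
def ITL1 : Formula → Prop := ITL (fun χ => FSAx χ ∨ CDAx χ)

/-- A valuation on a dynamical topological system `(X, T, S)`: a map from
formulas to open sets satisfying the semantic clauses. -/
structure DTValuation (X : Type) (T : TopologicalSpace X) (S : X → X) where
  val : Formula → Set X
  isOpen_val : ∀ φ, @IsOpen X T (val φ)
  val_bot : val .bot = ∅
  val_and : ∀ φ ψ, val (.and φ ψ) = val φ ∩ val ψ
  val_or : ∀ φ ψ, val (.or φ ψ) = val φ ∪ val ψ
  val_impl : ∀ φ ψ, val (.impl φ ψ) = @interior X T ((val φ)ᶜ ∪ val ψ)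
  val_next : ∀ φ, val (.next φ) = S ⁻¹' val φ
  val_diam : ∀ φ, val (.diam φ) = ⋃ n : ℕ, (S^[n]) ⁻¹' val φ
  val_box : ∀ φ, val (.box φ) =
    ⋃₀ {U : Set X | @IsOpen X T U ∧ S '' U ⊆ U ∧ U ⊆ val φ}

/-- The up-set topology of a preorder: the open sets are the upward closed sets. -/
def upsetTopology (X : Type) [Preorder X] : TopologicalSpace X where
  IsOpen U := IsUpperSet U
  isOpen_univ := isUpperSet_univ
  isOpen_inter := fun _ _ hU hV => hU.inter hV
  isOpen_sUnion := fun _ hs => isUpperSet_sUnion hs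

theorem isOpen_upsetTopology_iff {X : Type} [Preorder X] {U : Set X} :
    @IsOpen X (upsetTopology X) U ↔ IsUpperSet U :=
  Iff.rfl

theorem monotone_of_continuous_upsetTopology {X : Type} [Preorder X] {S : X → X}
    (hS : @Continuous X X (upsetTopology X) (upsetTopology X) S) : Monotone S := by
  intro x y hxy
  have hU : IsUpperSet (S ⁻¹' Set.Ici (S x)) :=
    (@continuous_def X X (upsetTopology X) (upsetTopology X) S).1 hS _ (isUpperSet_Ici (S x))
  exact hU hxy (Set.mem_Ici.2 le_rfl)

/-- An open map lifts the order backwards: any point above `S x` is the image of a point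
above `x`. -/
theorem exists_le_of_isOpenMap_upsetTopology {X : Type} [Preorder X] {S : X → X}
    (hS : @IsOpenMap X X (upsetTopology X) (upsetTopology X) S) {x z : X} (h : S x ≤ z) :
    ∃ y, x ≤ y ∧ S y = z := by
  have hU : IsUpperSet (S '' Set.Ici x) := hS _ (isUpperSet_Ici x)
  exact hU h ⟨x, Set.mem_Ici.2 le_rfl, rfl⟩

theorem exists_le_iterate_of_isOpenMap_upsetTopology {X : Type} [Preorder X] {S : X → X}
    (hS : @IsOpenMap X X (upsetTopology X) (upsetTopology X) S) (n : ℕ) {x z : X}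
    (h : S^[n] x ≤ z) : ∃ y, x ≤ y ∧ S^[n] y = z := by
  induction n generalizing x with
  | zero => exact ⟨z, h, rfl⟩
  | succ n ih =>
    obtain ⟨w, hw, rfl⟩ := ih (x := S x) h
    obtain ⟨y, hy, rfl⟩ := exists_le_of_isOpenMap_upsetTopology hS hw
    exact ⟨y, hy, rfl⟩

namespace DTValuation

variable {X : Type}

section Topological

variable {T : TopologicalSpace X} {S : X → X} (V : DTValuation X T S)

theorem not_mem_bot {x : X} : x ∉ V.val .bot := by
  simp [V.val_bot]

theorem mem_and {φ ψ : Formula} {x : X} : x ∈ V.val (.and φ ψ) ↔ x ∈ V.val φ ∧ x ∈ V.val ψ := by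
  simp [V.val_and]

theorem mem_or {φ ψ : Formula} {x : X} : x ∈ V.val (.or φ ψ) ↔ x ∈ V.val φ ∨ x ∈ V.val ψ := by
  simp [V.val_or]

theorem mem_next {φ : Formula} {x : X} : x ∈ V.val (.next φ) ↔ S x ∈ V.val φ := by
  simp [V.val_next]

theorem mem_diam {φ : Formula} {x : X} : x ∈ V.val (.diam φ) ↔ ∃ n, S^[n] x ∈ V.val φ := by
  simp [V.val_diam]

end Topological

variable [Preorder X] {S : X → X} (V : DTValuation X (upsetTopology X) S)

theorem val_mono {φ : Formula} {x y : X} (hxy : x ≤ y) (hx : x ∈ V.val φ) : y ∈ V.val φ :=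
  isOpen_upsetTopology_iff.1 (V.isOpen_val φ) hxy hx

theorem mem_impl {φ ψ : Formula} {x : X} :
    x ∈ V.val (.impl φ ψ) ↔ ∀ y, x ≤ y → y ∈ V.val φ → y ∈ V.val ψ := by
  constructor
  · intro hx y hxy hy
    have hy' := V.val_mono hxy hx
    rw [V.val_impl] at hy'
    exact (@interior_subset X (upsetTopology X) _ _ hy').resolve_left (fun h => h hy)
  · intro h
    rw [V.val_impl]
    refine (@mem_interior X (upsetTopology X) _ _).2
      ⟨Set.Ici x, fun y hy => ?_, isUpperSet_Ici x, Set.mem_Ici.2 le_rfl⟩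
    exact or_iff_not_imp_left.2 fun hn => h y hy (not_not.1 hn)

theorem mem_box (hS : Monotone S) {φ : Formula} {x : X} :
    x ∈ V.val (.box φ) ↔ ∀ n, S^[n] x ∈ V.val φ := by
  rw [V.val_box]
  constructor
  · rintro ⟨U, ⟨-, hSU, hU⟩, hx⟩ n
    exact hU ((Set.mapsTo_iff_image_subset.2 hSU).iterate n hx)
  · intro h
    refine ⟨{y | ∀ n, S^[n] y ∈ V.val φ}, ⟨?_, ?_, fun y hy => hy 0⟩, h⟩
    · exact fun y z hyz hy n => V.val_mono (hS.iterate n hyz) (hy n)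
    · rintro _ ⟨y, hy, rfl⟩ n
      exact hy (n + 1)

theorem mem_neg {φ : Formula} {x : X} : x ∈ V.val (.neg φ) ↔ ∀ y, x ≤ y → y ∉ V.val φ := by
  simp only [Formula.neg, V.mem_impl, V.not_mem_bot, imp_false]

theorem mem_iff {φ ψ : Formula} {x : X} :
    x ∈ V.val (.iff φ ψ) ↔ ∀ y, x ≤ y → (y ∈ V.val φ ↔ y ∈ V.val ψ) := by
  simp only [Formula.iff, V.mem_and, V.mem_impl]
  exact ⟨fun h y hy => ⟨h.1 y hy, h.2 y hy⟩,
    fun h => ⟨fun y hy => (h y hy).1, fun y hy => (h y hy).2⟩⟩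

theorem mem_of_FSAx (hS : Monotone S)
    (hSopen : @IsOpenMap X X (upsetTopology X) (upsetTopology X) S)
    {χ : Formula} (h : FSAx χ) (x : X) : x ∈ V.val χ := by
  obtain ⟨φ, ψ, rfl | rfl⟩ := h
  · refine V.mem_impl.2 fun y _ hy => V.mem_next.2 (V.mem_impl.2 fun z hz hφ => ?_)
    obtain ⟨w, hw, rfl⟩ := exists_le_of_isOpenMap_upsetTopology hSopen hz
    exact V.mem_next.1 (V.mem_impl.1 hy w hw (V.mem_next.2 hφ))
  · refine V.mem_impl.2 fun y _ hy => (V.mem_box hS).2 fun n => V.mem_impl.2 fun z hz hφ => ?_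
    obtain ⟨w, hw, rfl⟩ := exists_le_iterate_of_isOpenMap_upsetTopology hSopen n hz
    exact (V.mem_box hS).1 (V.mem_impl.1 hy w hw (V.mem_diam.2 ⟨n, hφ⟩)) n

theorem mem_of_CDAx (hS : Monotone S) {χ : Formula} (h : CDAx χ) (x : X) : x ∈ V.val χ := by
  obtain ⟨φ, ψ, rfl⟩ := h
  refine V.mem_impl.2 fun y _ hy => V.mem_or.2 (or_iff_not_imp_right.2 fun hψ => ?_)
  exact (V.mem_box hS).2 fun n =>
    (V.mem_or.1 ((V.mem_box hS).1 hy n)).resolve_right fun h => hψ (V.mem_diam.2 ⟨n, h⟩)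

/-- Soundness of `ITL⁰` plus extra axioms for a valuation, on a dynamic preorder, in which the
extra axioms hold everywhere. -/
theorem mem_of_ITL (hS : Monotone S) {Ax : Formula → Prop}
    (hAx : ∀ χ, Ax χ → ∀ x, x ∈ V.val χ) {φ : Formula} (h : ITL Ax φ) (x : X) : x ∈ V.val φ := by
  induction h generalizing x with
  | extra h => exact hAx _ h x
  | then1 φ ψ =>
    simp only [V.mem_impl]
    exact fun y _ hy z hz _ => V.val_mono hz hy
  | then2 φ ψ χ =>
    simp only [V.mem_impl]
    exact fun y _ h z hz h' w hw hφ => h w (hz.trans hw) hφ w le_rfl (h' w hw hφ)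
  | andE1 φ ψ => exact V.mem_impl.2 fun y _ hy => (V.mem_and.1 hy).1
  | andE2 φ ψ => exact V.mem_impl.2 fun y _ hy => (V.mem_and.1 hy).2
  | andI φ ψ =>
    simp only [V.mem_impl, V.mem_and]
    exact fun y _ hy z hz hψ => ⟨V.val_mono hz hy, hψ⟩
  | orI1 φ ψ => exact V.mem_impl.2 fun y _ hy => V.mem_or.2 (.inl hy)
  | orI2 φ ψ => exact V.mem_impl.2 fun y _ hy => V.mem_or.2 (.inr hy)
  | orE φ ψ χ =>
    simp only [V.mem_impl, V.mem_or]
    exact fun y _ h z hz h' w hw hor => hor.elim (h w (hz.trans hw)) (h' w hw)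
  | botE φ => exact V.mem_impl.2 fun y _ hy => (V.not_mem_bot hy).elim
  | nextBot => exact V.mem_neg.2 fun y _ hy => V.not_mem_bot (V.mem_next.1 hy)
  | nextAnd φ ψ => simp [V.mem_iff, V.mem_next, V.mem_and]
  | nextOr φ ψ => simp [V.mem_iff, V.mem_next, V.mem_or]
  | nextK φ ψ =>
    simp only [V.mem_impl, V.mem_next]
    exact fun y _ h z hz => h _ (hS hz)
  | boxK φ ψ =>
    simp only [V.mem_impl, V.mem_box hS]
    exact fun y _ h z hz hφ n => h n _ (hS.iterate n hz) (hφ n)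
  | diamK φ ψ =>
    simp only [V.mem_impl, V.mem_box hS, V.mem_diam]
    exact fun y _ h z hz ⟨n, hn⟩ => ⟨n, h n _ (hS.iterate n hz) hn⟩
  | diamOr φ ψ =>
    simp only [V.mem_impl, V.mem_or, V.mem_diam]
    exact fun y _ ⟨n, hn⟩ => hn.imp (fun h => ⟨n, h⟩) (fun h => ⟨n, h⟩)
  | boxFix φ =>
    simp only [V.mem_impl, V.mem_and, V.mem_next, V.mem_box hS]
    exact fun y _ hy => ⟨hy 0, fun n => hy (n + 1)⟩
  | diamFix φ =>
    simp only [V.mem_impl, V.mem_or, V.mem_next, V.mem_diam]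
    rintro y - (hy | ⟨n, hn⟩)
    · exact ⟨0, hy⟩
    · exact ⟨n + 1, hn⟩
  | @ind1 φ _ ih =>
    have step (y : X) (hy : y ∈ V.val φ) : S y ∈ V.val φ :=
      V.mem_next.1 (V.mem_impl.1 (ih y) y le_rfl hy)
    exact V.mem_impl.2 fun y _ hy => (V.mem_box hS).2 fun n => Set.MapsTo.iterate step n hy
  | @ind2 φ _ ih =>
    have back (n : ℕ) : ∀ y, S^[n] y ∈ V.val φ → y ∈ V.val φ := by
      induction n with
      | zero => exact fun y hy => hy
      | succ n ihn =>
        exact fun y hy => V.mem_impl.1 (ih y) y le_rfl (V.mem_next.2 (ihn (S y) hy))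
    refine V.mem_impl.2 fun y _ hy => ?_
    obtain ⟨n, hn⟩ := V.mem_diam.1 hy
    exact back n y hn
  | mp _ _ ih₁ ih₂ => exact V.mem_impl.1 (ih₁ x) x le_rfl (ih₂ x)
  | nec _ ih => exact V.mem_next.2 (ih (S x))

end DTValuation

/-- Corollary 1: soundness of ITL¹ for the class of persistent dynamic posets. -/
theorem itl1_sound (φ : Formula) (h : ITL1 φ)
    (X : Type) [PartialOrder X] (S : X → X)
    (hS : @Continuous X X (upsetTopology X) (upsetTopology X) S)
    (hSopen : @IsOpenMap X X (upsetTopology X) (upsetTopology X) S)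
    (V : DTValuation X (upsetTopology X) S) : V.val φ = Set.univ := by
  have hmono := monotone_of_continuous_upsetTopology hS
  refine Set.eq_univ_of_forall fun x => V.mem_of_ITL hmono (fun χ hχ y => ?_) h x
  exact hχ.elim (fun h => V.mem_of_FSAx hmono hSopen h y) (fun h => V.mem_of_CDAx hmono h y)
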